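/- arXiv:1110.0120 — 3 statements merged into one kernel-verified Lean document; each statement's English description precedes it below -/
import Mathlib

section
/- If the strictly increasing tuple (t_1 < t_2 < ⋯ < t_p) in T is a non-broken circuit, then the vectors v_{t_1}, v_{t_2}, …, v_{t_p} are linearly independent. -/
section NBC

variable (K : Type*) {V T : Type*} [Field K] [AddCommGroup V] [Module K V]
  [LinearOrder T] [Finite T]

/-- A strictly increasing tuple `(t_1 < ⋯ < t_m)` in `T` is a *circuit* if the family
`v_{t_1},…,v_{t_m}` is linearly dependent but every proper subset of it is linearly
independent. -/
def IsCircuit (v : T → V) {m : ℕ} (t : Fin m → T) : Prop :=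
  StrictMono t ∧ ¬ LinearIndependent K (v ∘ t) ∧
    ∀ s : Finset (Fin m), s ≠ Finset.univ → LinearIndependent K (fun j : s => v (t j.1))

/-- `(t_1,…,t_m)` is a *broken circuit* if `(t_1,…,t_m,x)` is a circuit for some `x ∈ T` with
`x > t_m`. -/
def IsBrokenCircuit (v : T → V) {m : ℕ} (t : Fin m → T) : Prop :=
  ∃ x : T, (∀ i, t i < x) ∧ IsCircuit K v (Fin.snoc t x)

/-- `(t_1,…,t_m)` is a *non-broken circuit* if it is strictly increasing and no subsequence of
it is a broken circuit. -/
def IsNBC (v : T → V) {m : ℕ} (t : Fin m → T) : Prop :=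
  StrictMono t ∧
    ∀ (k : ℕ) (g : Fin k → Fin m), StrictMono g → ¬ IsBrokenCircuit K v (t ∘ g)

end NBC

/-- A family indexed by `Fin p` that is linearly dependent has a strictly increasing dependent
subfamily all of whose proper subfamilies are linearly independent. -/
theorem exists_strictMono_minimal_dependent {K V : Type*} [Field K] [AddCommGroup V] [Module K V]
    {p : ℕ} {w : Fin p → V} (hw : ¬ LinearIndependent K w) :
    ∃ (k : ℕ) (g : Fin k → Fin p), StrictMono g ∧ ¬ LinearIndependent K (w ∘ g) ∧
      ∀ s : Finset (Fin k), s ≠ Finset.univ →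
        LinearIndependent K (fun j : s => w (g j.1)) := by
  classical
  have hex : ∃ k : ℕ, ∃ g : Fin k → Fin p, StrictMono g ∧ ¬ LinearIndependent K (w ∘ g) :=
    ⟨p, id, strictMono_id, hw⟩
  obtain ⟨g, hg, hdep⟩ := Nat.find_spec hex
  refine ⟨Nat.find hex, g, hg, hdep, fun s hs => ?_⟩
  have hlt : s.card < Nat.find hex := by
    simpa using Finset.card_lt_card (Finset.ssubset_univ_iff.2 hs)
  by_contra hind
  refine Nat.find_min hex hlt ⟨g ∘ s.orderEmbOfFin rfl,
    hg.comp (s.orderEmbOfFin rfl).strictMono, fun h => hind ?_⟩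
  exact (linearIndependent_equiv (s.orderIsoOfFin rfl).toEquiv).1 h

/-- If the strictly increasing tuple `(t_1 < ⋯ < t_p)` in `T` is a non-broken
circuit, then the vectors `v_{t_1}, …, v_{t_p}` are linearly independent. -/
theorem nbc_linearIndependent {K V T : Type*} [Field K] [AddCommGroup V] [Module K V]
    [LinearOrder T] [Finite T] (v : T → V) (hv : ∀ a, v a ≠ 0)
    {p : ℕ} (t : Fin p → T) (ht : IsNBC K v t) :
    LinearIndependent K (v ∘ t) := by
  by_contra hdep
  obtain ⟨k, g, hg, hgdep, hmin⟩ := exists_strictMono_minimal_dependent hdep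
  cases k with
  | zero => exact hgdep linearIndependent_empty_type
  | succ k =>
    have hsnoc : (Fin.snoc ((t ∘ g) ∘ Fin.castSucc) ((t ∘ g) (Fin.last k)) : Fin (k + 1) → T)
        = t ∘ g := Fin.snoc_init_self (t ∘ g)
    refine ht.2 k (g ∘ Fin.castSucc) (hg.comp Fin.strictMono_castSucc)
      ⟨t (g (Fin.last k)), fun i => ht.1 (hg (Fin.castSucc_lt_last i)), ?_⟩
    change IsCircuit K v (Fin.snoc ((t ∘ g) ∘ Fin.castSucc) ((t ∘ g) (Fin.last k)))
    rw [hsnoc]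
    exact ⟨ht.1.comp hg, hgdep, hmin⟩
end

section
/- If the strictly increasing tuple (t_1 < t_2 < ⋯ < t_p) in T is a non-broken circuit, then for every q with 1 ≤ q < p and every t ∈ T with t > t_q, the vectors v_{t_1}, …, v_{t_q}, v_t are linearly independent. -/
/-- A linearly dependent family indexed by an increasing tuple contains a circuit. -/
theorem exists_isCircuit_comp_of_not_linearIndependent
    {K V T : Type*} [Field K] [AddCommGroup V] [Module K V] [LinearOrder T]
    (v : T → V) {n : ℕ} {s : Fin n → T} (hs : StrictMono s)
    (hdep : ¬ LinearIndependent K (v ∘ s)) :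
    ∃ (k : ℕ) (g : Fin (k + 1) → Fin n), StrictMono g ∧ IsCircuit K v (s ∘ g) := by
  classical
  have hex : ∃ k, ∃ g : Fin k → Fin n, StrictMono g ∧ ¬ LinearIndependent K (v ∘ s ∘ g) :=
    ⟨n, id, strictMono_id, hdep⟩
  obtain ⟨g, hg, hgdep⟩ := Nat.find_spec hex
  have hmin := fun m => Nat.find_min (m := m) hex
  generalize Nat.find hex = k at g hg hgdep hmin
  rcases k with _ | k
  · exact absurd linearIndependent_empty_type hgdep
  refine ⟨k, g, hg, hs.comp hg, hgdep, fun S hS => ?_⟩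
  have hcard : S.card < k + 1 := by
    simpa using Finset.card_lt_card (Finset.ssubset_univ_iff.mpr hS)
  have hind : LinearIndependent K (v ∘ s ∘ g ∘ S.orderEmbOfFin rfl) := by
    by_contra h
    exact hmin _ hcard ⟨_, hg.comp (S.orderEmbOfFin rfl).strictMono, h⟩
  exact (linearIndependent_equiv (S.orderIsoOfFin rfl).toEquiv).mp hind

/-- If the strictly increasing tuple `(t_1 < ⋯ < t_p)` in `T` is a
non-broken circuit, then for every `q` with `1 ≤ q < p` and every `x ∈ T` with `x > t_q`, the
vectors `v_{t_1}, …, v_{t_q}, v_x` are linearly independent. -/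
theorem nbc_initial_extension_linearIndependent
    {K V T : Type*} [Field K] [AddCommGroup V] [Module K V]
    [LinearOrder T] [Finite T] (v : T → V) (hv : ∀ a, v a ≠ 0)
    {p : ℕ} (t : Fin p → T) (ht : IsNBC K v t) :
    ∀ (q : ℕ) (_ : 1 ≤ q) (hq : q < p) (x : T),
      t ⟨q - 1, by omega⟩ < x →
      LinearIndependent K
        (fun j : Fin (q + 1) => v (Fin.snoc (α := fun _ => T) (fun i : Fin q => t (Fin.castLE hq.le i)) x j)) := by
  intro q hq1 hq x hx
  set s : Fin (q + 1) → T :=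
    Fin.snoc (α := fun _ => T) (fun i : Fin q => t (Fin.castLE hq.le i)) x with hs_def
  have hs_castSucc (i : Fin q) : s i.castSucc = t (Fin.castLE hq.le i) := by simp [hs_def]
  have hs : StrictMono s := by
    intro i j hij
    obtain ⟨i, rfl⟩ := Fin.exists_castSucc_eq.mpr (Fin.ne_last_of_lt hij)
    induction j using Fin.lastCases with
    | last =>
      have hle : t (Fin.castLE hq.le i) ≤ t ⟨q - 1, by omega⟩ :=
        ht.1.monotone (Fin.mk_le_mk.mpr (by have := i.isLt; omega))
      simpa [hs_def] using hle.trans_lt hx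
    | cast j =>
      rw [hs_castSucc, hs_castSucc]
      exact ht.1 hij
  by_contra hdep
  obtain ⟨k, g, hg, hcirc⟩ := exists_isCircuit_comp_of_not_linearIndependent v hs hdep
  have hlt (i : Fin k) : g i.castSucc < g (Fin.last k) := hg (Fin.castSucc_lt_last i)
  choose g' hg' using fun i => Fin.exists_castSucc_eq.mpr (Fin.ne_last_of_lt (hlt i))
  have hst (i : Fin k) : t (Fin.castLE hq.le (g' i)) = s (g i.castSucc) := by
    rw [← hg', hs_castSucc]
  have hmono : StrictMono fun i => Fin.castLE hq.le (g' i) := by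
    intro i j hij
    have h := hg (Fin.castSucc_lt_castSucc_iff.mpr hij)
    rw [← hg', ← hg'] at h
    exact h
  refine ht.2 k _ hmono ⟨s (g (Fin.last k)), fun i => ?_, ?_⟩
  · exact (hst i).trans_lt (hs (hlt i))
  · convert hcirc using 1
    funext i
    induction i using Fin.lastCases with
    | last => simp
    | cast i => simpa using hst i
end

section
/- Let (t_1 < t_2 < ⋯ < t_p) be a strictly increasing tuple in T such that the vectors v_{t_1},…,v_{t_p} are linearly independent and no proper subsequence of (t_1,…,t_p) is a broken circuit. If there exists t ∈ T with t > t_p such that v_{t_1},…,v_{t_p},v_t are linearly dependent, then (t_1,…,t_p,t) is a circuit; in particular (t_1,…,t_p) is a broken circuit, and it is minimal in the sense that no proper subsequence of it is a broken circuit. -/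
/-- A strictly increasing dependent tuple is a circuit as soon as deleting any single entry leaves
an independent family. -/
theorem isCircuit_of_succAbove {K V T : Type*} [Field K] [AddCommGroup V] [Module K V]
    [LinearOrder T] [Finite T] (v : T → V) {m : ℕ} (u : Fin (m + 1) → T) (hu : StrictMono u)
    (hdep : ¬ LinearIndependent K (v ∘ u))
    (hdel : ∀ i : Fin (m + 1), LinearIndependent K (v ∘ u ∘ i.succAbove)) :
    IsCircuit K v u := by
  refine ⟨hu, hdep, fun s hs => ?_⟩
  obtain ⟨i, hi⟩ : ∃ i, i ∉ s := by
    by_contra! h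
    exact hs (Finset.eq_univ_iff_forall.2 h)
  have hne : ∀ j : s, ∃ l, i.succAbove l = j.1 := fun j =>
    Fin.exists_succAbove_eq fun h => hi (h ▸ j.2)
  choose f hf using hne
  have hf_inj : Function.Injective f := fun a b hab =>
    Subtype.ext (by rw [← hf a, ← hf b, hab])
  simpa only [Function.comp_def, hf] using (hdel i).comp f hf_inj

theorem strictMono_snoc {T : Type*} [Preorder T] {m : ℕ} {t : Fin m → T} (ht : StrictMono t)
    {x : T} (hx : ∀ i, t i < x) : StrictMono (Fin.snoc (α := fun _ => T) t x) := by
  intro a b hab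
  induction b using Fin.lastCases with
  | last =>
    induction a using Fin.lastCases with
    | last => exact absurd hab (lt_irrefl _)
    | cast a => simpa using hx a
  | cast b =>
    induction a using Fin.lastCases with
    | last => exact absurd hab (Fin.castSucc_lt_last b).not_gt
    | cast a => simpa using ht (Fin.castSucc_lt_castSucc_iff.1 hab)

/-- If appending `x` to an independent increasing tuple makes it dependent, some subsequence
becomes a circuit on appending `x`. -/
theorem exists_subsequence_isCircuit_snoc {K V T : Type*} [Field K] [AddCommGroup V] [Module K V]
    [LinearOrder T] [Finite T] (v : T → V) {p : ℕ} (t : Fin p → T) (hmono : StrictMono t)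
    (hind : LinearIndependent K (v ∘ t)) (x : T) (hx : ∀ i, t i < x)
    (hdep : ¬ LinearIndependent K (v ∘ Fin.snoc (α := fun _ => T) t x)) :
    ∃ (k : ℕ) (g : Fin k → Fin p), StrictMono g ∧
      IsCircuit K v (Fin.snoc (α := fun _ => T) (t ∘ g) x) := by
  classical
  have hex : ∃ (k : ℕ) (g : Fin k → Fin p), StrictMono g ∧
      ¬ LinearIndependent K (v ∘ Fin.snoc (α := fun _ => T) (t ∘ g) x) :=
    ⟨p, id, strictMono_id, hdep⟩
  obtain ⟨g, hg, hgdep⟩ := Nat.find_spec hex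
  have hmin := fun k => Nat.find_min (m := k) hex
  generalize Nat.find hex = k at g hg hgdep hmin
  refine ⟨k, g, hg, isCircuit_of_succAbove v _
    (strictMono_snoc (hmono.comp hg) fun i => hx (g i)) hgdep fun i => ?_⟩
  induction i using Fin.lastCases with
  | last =>
    have h : Fin.snoc (α := fun _ => T) (t ∘ g) x ∘ (Fin.last k).succAbove = t ∘ g := by
      ext j
      simp
    rw [h]
    exact hind.comp g hg.injective
  | cast i =>
    obtain _ | k := k
    · exact i.elim0
    have h : Fin.snoc (α := fun _ => T) (t ∘ g) x ∘ i.castSucc.succAbove =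
        Fin.snoc (α := fun _ => T) (t ∘ g ∘ i.succAbove) x := by
      ext j
      induction j using Fin.lastCases with
      | last => simp
      | cast j => simp
    rw [h]
    by_contra hcon
    exact hmin k k.lt_succ_self ⟨_, hg.comp (Fin.strictMono_succAbove i), hcon⟩

/-- Let `(t_1 < ⋯ < t_p)` be strictly increasing with `v_{t_1},…,v_{t_p}`
linearly independent and no proper subsequence a broken circuit.  If `x ∈ T` with `x > t_p`
is such that `v_{t_1},…,v_{t_p},v_x` are linearly dependent, then `(t_1,…,t_p,x)` is a
circuit; in particular `(t_1,…,t_p)` is a broken circuit, and it is minimal in the sense that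
no proper subsequence of it is a broken circuit. -/
theorem minimal_broken_circuit_of_dependent_extension
    {K V T : Type*} [Field K] [AddCommGroup V] [Module K V]
    [LinearOrder T] [Finite T] (v : T → V) (hv : ∀ a, v a ≠ 0)
    {p : ℕ} (t : Fin p → T) (hmono : StrictMono t)
    (hind : LinearIndependent K (v ∘ t))
    (hmin : ∀ (k : ℕ) (g : Fin k → Fin p), k < p → StrictMono g →
      ¬ IsBrokenCircuit K v (t ∘ g))
    (x : T) (hx : ∀ i, t i < x)
    (hdep : ¬ LinearIndependent K (v ∘ Fin.snoc (α := fun _ => T) t x)) :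
    IsCircuit K v (Fin.snoc (α := fun _ => T) t x) ∧
      IsBrokenCircuit K v t ∧
      ∀ (k : ℕ) (g : Fin k → Fin p), k < p → StrictMono g →
        ¬ IsBrokenCircuit K v (t ∘ g) := by
  obtain ⟨k, g, hg, hcirc⟩ := exists_subsequence_isCircuit_snoc v t hmono hind x hx hdep
  have hkp : p ≤ k := by
    by_contra! hlt
    exact hmin k g hlt hg ⟨x, fun i => hx (g i), hcirc⟩
  obtain rfl : k = p :=
    le_antisymm (by simpa using Fintype.card_le_of_injective g hg.injective) hkp
  have hgid : g = id := by
    ext i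
    exact congrArg Fin.val (congrArg (· i) (congrArg DFunLike.coe
      (Subsingleton.elim (hg.orderIsoOfSurjective g
        (Finite.injective_iff_surjective.1 hg.injective)) (OrderIso.refl _))))
  rw [hgid, Function.comp_id] at hcirc
  exact ⟨hcirc, ⟨x, hx, hcirc⟩, hmin⟩
end
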